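/- (Kernel-level observability implies thickness.) Let ω ⊂ ℍ² be a Borel set and suppose there exists a constant C_obs > 0 such that for every z₀ ∈ ℍ², ∫_{ℍ²} H(2, z, z₀)² dvol_g(z) ≤ C_obs ∫_0^1 ∫_ω H(s+1, z, z₀)² dvol_g(z) ds. Then there exist R, δ > 0 such that ω is (δ,R)-thick, i.e. vol_g(ω ∩ B^g_R(z₀)) ≥ δ for every z₀ ∈ ℍ². -/

import Mathlib

open MeasureTheory Real Set

/-- Inverse hyperbolic cosine. -/
noncomputable def arcoshR (x : ℝ) : ℝ := Real.log (x + Real.sqrt (x ^ 2 - 1))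

/-- The hyperbolic half-plane, as a subset of `ℝ × ℝ`. -/
def H2 : Set (ℝ × ℝ) := {z | 0 < z.2}

/-- The geodesic distance on the hyperbolic half-plane. -/
noncomputable def hypDist (z z' : ℝ × ℝ) : ℝ :=
  arcoshR (1 + ((z.1 - z'.1) ^ 2 + (z.2 - z'.2) ^ 2) / (2 * z.2 * z'.2))

/-- The heat kernel of the hyperbolic half-plane. -/
noncomputable def heatH (t : ℝ) (z z' : ℝ × ℝ) : ℝ :=
  Real.sqrt 2 / (4 * Real.pi * t) ^ ((3 : ℝ) / 2) * Real.exp (-t / 4) *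
    ∫ s in Set.Ioi (hypDist z z'),
      s * Real.exp (-s ^ 2 / (4 * t)) / Real.sqrt (Real.cosh s - Real.cosh (hypDist z z'))

/-- The open geodesic ball of center `z` and radius `r`. -/
def hypBall (z : ℝ × ℝ) (r : ℝ) : Set (ℝ × ℝ) := {z' ∈ H2 | hypDist z z' < r}

/-- The Riemannian measure `dvol_g = dx dy / y²` of the hyperbolic half-plane. -/
noncomputable def volG : Measure (ℝ × ℝ) :=
  (volume : Measure (ℝ × ℝ)).withDensity fun z => ENNReal.ofReal (z.2 ^ 2)⁻¹

/-- The hyperbolic cosine of the geodesic distance on the half-plane. -/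
noncomputable def coshDist (z z' : ℝ × ℝ) : ℝ :=
  1 + ((z.1 - z'.1) ^ 2 + (z.2 - z'.2) ^ 2) / (2 * z.2 * z'.2)

theorem one_le_coshDist {z z' : ℝ × ℝ} (hz : z ∈ H2) (hz' : z' ∈ H2) : 1 ≤ coshDist z z' := by
  have h1 : 0 < z.2 := hz
  have h2 : 0 < z'.2 := hz'
  have : 0 ≤ ((z.1 - z'.1) ^ 2 + (z.2 - z'.2) ^ 2) / (2 * z.2 * z'.2) := by positivity
  unfold coshDist
  linarith

theorem cosh_hypDist {z z' : ℝ × ℝ} (hz : z ∈ H2) (hz' : z' ∈ H2) :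
    cosh (hypDist z z') = coshDist z z' :=
  Real.cosh_arcosh (one_le_coshDist hz hz')

theorem hypDist_nonneg {z z' : ℝ × ℝ} (hz : z ∈ H2) (hz' : z' ∈ H2) : 0 ≤ hypDist z z' :=
  Real.arcosh_nonneg (one_le_coshDist hz hz')

theorem hypDist_comm (z z' : ℝ × ℝ) : hypDist z z' = hypDist z' z := by
  unfold hypDist
  congr 3 <;> ring

theorem measurable_hypDist_left (z' : ℝ × ℝ) : Measurable fun z => hypDist z z' := by
  unfold hypDist arcoshR
  fun_prop

theorem zero_one_mem_H2 : ((0, 1) : ℝ × ℝ) ∈ H2 := zero_lt_one' ℝ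

theorem measurableSet_H2 : MeasurableSet H2 := measurableSet_lt measurable_const measurable_snd

theorem measurableSet_hypBall (z : ℝ × ℝ) (r : ℝ) : MeasurableSet (hypBall z r) := by
  have h : MeasurableSet {z' | hypDist z' z < r} :=
    measurableSet_lt (measurable_hypDist_left z) measurable_const
  simp only [hypDist_comm _ z] at h
  exact measurableSet_H2.inter h

/-- The orientation-preserving similarity of the half-plane taking `(0, 1)` to `z₀`. -/
def similarity (z₀ z : ℝ × ℝ) : ℝ × ℝ := (z₀.1 + z₀.2 * z.1, z₀.2 * z.2)

theorem similarity_mem_H2 {z₀ : ℝ × ℝ} (h₀ : z₀ ∈ H2) (z : ℝ × ℝ) :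
    similarity z₀ z ∈ H2 ↔ z ∈ H2 := by
  have h : 0 < z₀.2 := h₀
  exact mul_pos_iff_of_pos_left h

theorem hypDist_similarity {z₀ : ℝ × ℝ} (h₀ : z₀ ∈ H2) (z : ℝ × ℝ) :
    hypDist (similarity z₀ z) z₀ = hypDist z (0, 1) := by
  have h : z₀.2 ≠ 0 := ne_of_gt h₀
  unfold hypDist similarity
  congr 2
  by_cases hz : z.2 = 0
  · simp [hz]
  · field_simp
    ring

theorem heatH_similarity {z₀ : ℝ × ℝ} (h₀ : z₀ ∈ H2) (t : ℝ) (z : ℝ × ℝ) :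
    heatH t (similarity z₀ z) z₀ = heatH t z (0, 1) := by
  unfold heatH
  rw [hypDist_similarity h₀]

theorem measurableEmbedding_similarity {z₀ : ℝ × ℝ} (h₀ : z₀ ∈ H2) :
    MeasurableEmbedding (similarity z₀) := by
  have h : similarity z₀ = (fun z => (z₀.1, (0 : ℝ)) + z) ∘ fun z => z₀.2 • z := by
    ext z <;> simp [similarity]
  rw [h]
  exact (measurableEmbedding_addLeft _).comp
    (measurableEmbedding_const_smul₀ (ne_of_gt h₀))

theorem map_similarity_volume {z₀ : ℝ × ℝ} (h₀ : z₀ ∈ H2) :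
    (volume : Measure (ℝ × ℝ)).map (similarity z₀) = ENNReal.ofReal (z₀.2 ^ 2)⁻¹ • volume := by
  have h : similarity z₀ = (fun z => (z₀.1, (0 : ℝ)) + z) ∘ fun z => z₀.2 • z := by
    ext z <;> simp [similarity]
  rw [h, ← Measure.map_map (by fun_prop) (by fun_prop),
    Measure.map_addHaar_smul volume (ne_of_gt h₀), Measure.map_smul, map_add_left_eq_self]
  simp

theorem measurePreserving_similarity {z₀ : ℝ × ℝ} (h₀ : z₀ ∈ H2) :
    MeasurePreserving (similarity z₀) volG volG := by
  have hemb := measurableEmbedding_similarity h₀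
  have h0 : 0 < z₀.2 := h₀
  refine ⟨hemb.measurable, Measure.ext fun s hs => ?_⟩
  rw [hemb.map_apply, volG, withDensity_apply _ (hemb.measurable hs), withDensity_apply _ hs]
  have h1 : ∀ z : ℝ × ℝ, ENNReal.ofReal (z.2 ^ 2)⁻¹ =
      ENNReal.ofReal (z₀.2 ^ 2) * ENNReal.ofReal ((similarity z₀ z).2 ^ 2)⁻¹ := by
    intro z
    rw [← ENNReal.ofReal_mul (by positivity), similarity]
    congr 1
    rw [mul_pow, mul_inv, mul_inv_cancel_left₀ (by positivity)]
  rw [lintegral_congr h1, lintegral_const_mul' _ _ ENNReal.ofReal_ne_top,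
    ← hemb.lintegral_map (μ := volume.restrict (similarity z₀ ⁻¹' s))
      (fun z => ENNReal.ofReal (z.2 ^ 2)⁻¹), ← hemb.restrict_map, map_similarity_volume h₀,
    Measure.restrict_smul, lintegral_smul_measure, smul_eq_mul, ← mul_assoc,
    ← ENNReal.ofReal_mul (by positivity), mul_inv_cancel₀ (by positivity), ENNReal.ofReal_one,
    one_mul]

theorem half_sq_sub_sq_le_cosh_sub_cosh {d s : ℝ} (hd : 0 ≤ d) (hs : d ≤ s) :
    (s ^ 2 - d ^ 2) / 2 ≤ cosh s - cosh d := by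
  have h1 : cosh s - cosh d = 2 * (sinh ((s + d) / 2) * sinh ((s - d) / 2)) := by
    have e1 : cosh s = cosh ((s + d) / 2 + (s - d) / 2) := by congr 1; ring
    have e2 : cosh d = cosh ((s + d) / 2 - (s - d) / 2) := by congr 1; ring
    rw [e1, e2, cosh_add, cosh_sub]
    ring
  have ha := self_le_sinh_iff.2 (show 0 ≤ (s + d) / 2 by linarith)
  have hb := self_le_sinh_iff.2 (show 0 ≤ (s - d) / 2 by linarith)
  have := mul_le_mul ha hb (by linarith) (by linarith)
  rw [h1]
  linarith

/-- The integrand of the heat kernel at distance `d`. -/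
noncomputable def heatIntegrand (t d s : ℝ) : ℝ :=
  s * exp (-s ^ 2 / (4 * t)) / √(cosh s - cosh d)

theorem heatIntegrand_nonneg {t d s : ℝ} (hs : 0 ≤ s) : 0 ≤ heatIntegrand t d s := by
  unfold heatIntegrand
  positivity

theorem heatIntegrand_pos {t d s : ℝ} (hd : 0 ≤ d) (hs : d < s) : 0 < heatIntegrand t d s := by
  have h0 : 0 < s := hd.trans_lt hs
  have : 0 < cosh s - cosh d := by
    rw [sub_pos, cosh_lt_cosh, abs_of_nonneg hd, abs_of_pos h0]
    exact hs
  unfold heatIntegrand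
  positivity

theorem heatIntegrand_le {t d s : ℝ} (ht : 0 < t) (ht2 : t ≤ 2) (hd : 0 ≤ d) (hs : d < s) :
    heatIntegrand t d s ≤ exp (-d ^ 2 / 8) *
      (|2 * s| • (exp (-(s ^ 2 - d ^ 2) / 8) * (2 * √((s ^ 2 - d ^ 2) / 2))⁻¹)) := by
  have h0 : 0 < s := hd.trans_lt hs
  have hsd : 0 < (s ^ 2 - d ^ 2) / 2 := by nlinarith
  have hexp : exp (-s ^ 2 / (4 * t)) ≤ exp (-s ^ 2 / 8) := by
    rw [exp_le_exp, neg_div, neg_div, neg_le_neg_iff]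
    gcongr
    linarith
  calc heatIntegrand t d s ≤ s * exp (-s ^ 2 / 8) / √((s ^ 2 - d ^ 2) / 2) := by
        unfold heatIntegrand
        gcongr
        exact half_sq_sub_sq_le_cosh_sub_cosh hd hs.le
    _ = _ := by
        have : exp (-s ^ 2 / 8) = exp (-d ^ 2 / 8) * exp (-(s ^ 2 - d ^ 2) / 8) := by
          rw [← exp_add]
          congr 1
          ring
        rw [this, abs_of_pos (by positivity), smul_eq_mul]
        field_simp

theorem integrableOn_exp_mul_inv_sqrt :
    IntegrableOn (fun v : ℝ => exp (-v / 8) * (2 * √(v / 2))⁻¹) (Ioi 0) := by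
  have h := (integrableOn_rpow_mul_exp_neg_mul_rpow (p := 1) (s := -(1 / 2)) (b := 1 / 8)
    (by norm_num) (by norm_num) (by norm_num)).const_mul (√2 / 2)
  refine IntegrableOn.congr_fun h (fun v hv => ?_) measurableSet_Ioi
  have hv : 0 < v := hv
  have h2 : √2 * √2 = 2 := mul_self_sqrt (by norm_num)
  have h3 : (0 : ℝ) < √2 := by positivity
  have h4 : 0 < √v := by positivity
  simp only [rpow_one]
  rw [rpow_neg hv.le, ← sqrt_eq_rpow, sqrt_div hv.le, show -(1 / 8) * v = -v / 8 by ring]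
  field_simp

theorem image_sq_sub_sq {d : ℝ} (hd : 0 ≤ d) : (fun s => s ^ 2 - d ^ 2) '' Ioi d = Ioi 0 := by
  ext v
  simp only [mem_image, mem_Ioi]
  constructor
  · rintro ⟨s, hs, rfl⟩
    nlinarith
  · intro hv
    refine ⟨√(v + d ^ 2), lt_sqrt_of_sq_lt (by linarith), ?_⟩
    rw [sq_sqrt (by positivity)]
    ring

theorem hasDerivWithinAt_sq_sub_sq (d : ℝ) :
    ∀ s ∈ Ioi d, HasDerivWithinAt (fun s => s ^ 2 - d ^ 2) (2 * s) (Ioi d) s := fun s _ => by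
  simpa using ((hasDerivAt_pow 2 s).sub_const (d ^ 2)).hasDerivWithinAt

theorem injOn_sq_sub_sq {d : ℝ} (hd : 0 ≤ d) : InjOn (fun s => s ^ 2 - d ^ 2) (Ioi d) := by
  intro a ha b hb hab
  have ha : d < a := ha
  have hb : d < b := hb
  exact (sq_eq_sq₀ (hd.trans ha.le) (hd.trans hb.le)).1 (sub_left_inj.1 hab)

theorem integrableOn_heatIntegrand_majorant {d : ℝ} (hd : 0 ≤ d) :
    IntegrableOn (fun s => |2 * s| • (exp (-(s ^ 2 - d ^ 2) / 8) *
      (2 * √((s ^ 2 - d ^ 2) / 2))⁻¹)) (Ioi d) := by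
  rw [← integrableOn_image_iff_integrableOn_abs_deriv_smul measurableSet_Ioi
    (hasDerivWithinAt_sq_sub_sq d) (injOn_sq_sub_sq hd)
    (fun v : ℝ => exp (-v / 8) * (2 * √(v / 2))⁻¹), image_sq_sub_sq hd]
  exact integrableOn_exp_mul_inv_sqrt

theorem integrableOn_heatIntegrand {t d : ℝ} (ht : 0 < t) (ht2 : t ≤ 2) (hd : 0 ≤ d) :
    IntegrableOn (heatIntegrand t d) (Ioi d) := by
  refine Integrable.mono' ((integrableOn_heatIntegrand_majorant hd).const_mul (exp (-d ^ 2 / 8)))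
    (Measurable.aestronglyMeasurable (by unfold heatIntegrand; fun_prop)) ?_
  filter_upwards [ae_restrict_mem measurableSet_Ioi] with s hs
  rw [norm_of_nonneg (heatIntegrand_nonneg (hd.trans (le_of_lt hs)))]
  exact heatIntegrand_le ht ht2 hd hs

theorem integral_heatIntegrand_le {t d : ℝ} (ht : 0 < t) (ht2 : t ≤ 2) (hd : 0 ≤ d) :
    ∫ s in Ioi d, heatIntegrand t d s ≤
      exp (-d ^ 2 / 8) * ∫ v in Ioi 0, exp (-v / 8) * (2 * √(v / 2))⁻¹ := by
  rw [← image_sq_sub_sq hd, integral_image_eq_integral_abs_deriv_smul measurableSet_Ioi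
    (hasDerivWithinAt_sq_sub_sq d) (injOn_sq_sub_sq hd), ← integral_const_mul]
  exact setIntegral_mono_on (integrableOn_heatIntegrand ht ht2 hd)
    ((integrableOn_heatIntegrand_majorant hd).const_mul _) measurableSet_Ioi
    fun s hs => heatIntegrand_le ht ht2 hd hs

theorem integral_heatIntegrand_pos {t d : ℝ} (ht : 0 < t) (ht2 : t ≤ 2) (hd : 0 ≤ d) :
    0 < ∫ s in Ioi d, heatIntegrand t d s := by
  rw [setIntegral_pos_iff_support_of_nonneg_ae _ (integrableOn_heatIntegrand ht ht2 hd)]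
  · have : Ioi d ⊆ Function.support (heatIntegrand t d) ∩ Ioi d :=
      fun s hs => ⟨(heatIntegrand_pos hd hs).ne', hs⟩
    refine lt_of_lt_of_le ?_ (measure_mono this)
    simp
  · filter_upwards [ae_restrict_mem measurableSet_Ioi] with s hs
    exact heatIntegrand_nonneg (hd.trans (le_of_lt hs))

theorem heatH_eq (t : ℝ) (z z' : ℝ × ℝ) :
    heatH t z z' = √2 / (4 * π * t) ^ ((3 : ℝ) / 2) * exp (-t / 4) *
      ∫ s in Ioi (hypDist z z'), heatIntegrand t (hypDist z z') s := rfl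

theorem heatH_pos {t : ℝ} (ht : 0 < t) (ht2 : t ≤ 2) {z z' : ℝ × ℝ} (hz : z ∈ H2)
    (hz' : z' ∈ H2) : 0 < heatH t z z' := by
  rw [heatH_eq]
  have := integral_heatIntegrand_pos ht ht2 (hypDist_nonneg hz hz')
  positivity

theorem measurable_heatH_left (t : ℝ) (z' : ℝ × ℝ) : Measurable fun z => heatH t z z' := by
  have h : StronglyMeasurable fun p : ℝ × ℝ =>
      {p : ℝ × ℝ | p.1 < p.2}.indicator (fun p => heatIntegrand t p.1 p.2) p := by
    refine StronglyMeasurable.indicator (Measurable.stronglyMeasurable ?_)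
      (measurableSet_lt measurable_fst measurable_snd)
    unfold heatIntegrand
    fun_prop
  have h2 : Measurable fun d => ∫ s in Ioi d, heatIntegrand t d s := by
    convert! (h.integral_prod_right' (ν := volume)).measurable using 2 with d
    rw [← integral_indicator measurableSet_Ioi]
    rfl
  simp_rw [heatH_eq]
  exact (h2.comp (measurable_hypDist_left z')).const_mul _

theorem exists_heatH_sq_le : ∃ K > 0, ∀ t ∈ Icc (1 : ℝ) 2, ∀ z ∈ H2, ∀ z' ∈ H2,
    heatH t z z' ^ 2 ≤ K * (coshDist z z' ^ 3)⁻¹ := by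
  set A := ∫ v in Ioi (0 : ℝ), exp (-v / 8) * (2 * √(v / 2))⁻¹ with hA
  have hA0 : 0 ≤ A := setIntegral_nonneg measurableSet_Ioi fun v _ => by positivity
  refine ⟨2 * (A ^ 2 + 1) * exp 9, by positivity, fun t ht z hz z' hz' => ?_⟩
  obtain ⟨ht1, ht2⟩ := ht
  have hd := hypDist_nonneg hz hz'
  rw [← cosh_hypDist hz hz']
  have hpos := heatH_pos (by linarith) ht2 hz hz'
  have hle : heatH t z z' ≤ √2 * (exp (-hypDist z z' ^ 2 / 8) * A) := by
    rw [heatH_eq]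
    refine mul_le_mul ?_ (integral_heatIntegrand_le (by linarith) ht2 hd)
      (integral_heatIntegrand_pos (by linarith) ht2 hd).le (by positivity)
    have h1 : 1 ≤ (4 * π * t) ^ ((3 : ℝ) / 2) :=
      one_le_rpow (by nlinarith [pi_gt_three]) (by norm_num)
    calc √2 / (4 * π * t) ^ ((3 : ℝ) / 2) * exp (-t / 4) ≤ √2 * 1 :=
          mul_le_mul (div_le_self (by positivity) h1) (exp_le_one_iff.2 (by linarith))
            (by positivity) (by positivity)
      _ = √2 := mul_one _
  generalize hypDist z z' = d at *
  have hcosh : (exp d ^ 3)⁻¹ ≤ (cosh d ^ 3)⁻¹ := by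
    have : cosh d ≤ exp d := by
      rw [← cosh_add_sinh]
      linarith [sinh_nonneg_iff.2 hd]
    gcongr
  calc heatH t z z' ^ 2 ≤ (√2 * (exp (-d ^ 2 / 8) * A)) ^ 2 := by gcongr
    _ = 2 * A ^ 2 * exp (-d ^ 2 / 4) := by
        rw [mul_pow, sq_sqrt (by norm_num), mul_pow, ← exp_nat_mul]
        push_cast
        rw [show 2 * (-d ^ 2 / 8) = -d ^ 2 / 4 by ring]
        ring
    _ ≤ 2 * (A ^ 2 + 1) * (exp 9 * (exp d ^ 3)⁻¹) := by
        have : exp (-d ^ 2 / 4) ≤ exp 9 * (exp d ^ 3)⁻¹ := by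
          rw [← exp_nat_mul, ← exp_neg, ← exp_add, exp_le_exp]
          push_cast
          nlinarith [sq_nonneg (d / 2 - 3)]
        gcongr
        linarith
    _ ≤ 2 * (A ^ 2 + 1) * exp 9 * (cosh d ^ 3)⁻¹ := by
        rw [← mul_assoc]
        gcongr

theorem setLIntegral_inv_coshDist_sq_lt_top :
    ∫⁻ z in H2, ENNReal.ofReal (coshDist z (0, 1) ^ 2)⁻¹ ∂volG < ⊤ := by
  have hint : Integrable (fun z : ℝ × ℝ => 4 * (1 + ‖z‖ ^ 2) ^ (-(4 : ℝ) / 2)) volume :=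
    (integrable_rpow_neg_one_add_norm_sq (by simp; norm_num)).const_mul 4
  rw [volG, setLIntegral_withDensity_eq_setLIntegral_mul_non_measurable _ (by fun_prop)
    _ measurableSet_H2 (by simp)]
  refine lt_of_le_of_lt ?_ hint.lintegral_lt_top
  refine (setLIntegral_mono' measurableSet_H2 fun z hz => ?_).trans (setLIntegral_le_lintegral H2 _)
  have hy : 0 < z.2 := hz
  rw [Pi.mul_apply, ← ENNReal.ofReal_mul (by positivity)]
  apply ENNReal.ofReal_le_ofReal
  have hc : coshDist z (0, 1) = (1 + (z.1 ^ 2 + z.2 ^ 2)) / (2 * z.2) := by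
    unfold coshDist
    field_simp
    ring
  have hn : ‖z‖ ^ 2 ≤ z.1 ^ 2 + z.2 ^ 2 := by
    rw [Prod.norm_def]
    rcases max_choice ‖z.1‖ ‖z.2‖ with h | h <;> rw [h, norm_eq_abs, sq_abs] <;> nlinarith
  calc (z.2 ^ 2)⁻¹ * (coshDist z (0, 1) ^ 2)⁻¹ = 4 * ((1 + (z.1 ^ 2 + z.2 ^ 2)) ^ 2)⁻¹ := by
        rw [hc]
        field_simp
        ring
    _ ≤ 4 * ((1 + ‖z‖ ^ 2) ^ 2)⁻¹ := by gcongr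
    _ = 4 * (1 + ‖z‖ ^ 2) ^ (-(4 : ℝ) / 2) := by
        rw [show -(4 : ℝ) / 2 = -((2 : ℕ) : ℝ) by norm_num, rpow_neg (by positivity),
          rpow_natCast]

theorem volG_H2_pos : 0 < volG H2 := by
  have hopen : IsOpen H2 := isOpen_lt continuous_const continuous_snd
  rw [pos_iff_ne_zero, volG, withDensity_apply _ measurableSet_H2, ← pos_iff_ne_zero,
    setLIntegral_pos_iff (by fun_prop)]
  have : H2 ⊆ (Function.support fun z : ℝ × ℝ => ENNReal.ofReal (z.2 ^ 2)⁻¹) ∩ H2 := by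
    intro z hz
    have hy : 0 < z.2 := hz
    exact ⟨(ENNReal.ofReal_pos.2 (by positivity)).ne', hz⟩
  exact (hopen.measure_pos volume ⟨(0, 1), zero_one_mem_H2⟩).trans_le (measure_mono this)

theorem setLIntegral_heatH_sq_pos {t : ℝ} (ht : 0 < t) (ht2 : t ≤ 2) {z' : ℝ × ℝ}
    (hz' : z' ∈ H2) : 0 < ∫⁻ z in H2, ENNReal.ofReal (heatH t z z' ^ 2) ∂volG := by
  have := measurable_heatH_left t z'
  rw [setLIntegral_pos_iff (by fun_prop)]
  refine volG_H2_pos.trans_le (measure_mono fun z hz => ⟨?_, hz⟩)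
  have := heatH_pos ht ht2 hz hz'
  exact ne_of_gt (ENNReal.ofReal_pos.2 (by positivity))

/-- Splitting the observed energy into a ball, where the kernel is bounded, and its complement,
where the kernel decays. -/
theorem setLIntegral_heatH_sq_le {K : ℝ} (hK : 0 < K)
    (hbound : ∀ t ∈ Icc (1 : ℝ) 2, ∀ z ∈ H2, ∀ z' ∈ H2,
      heatH t z z' ^ 2 ≤ K * (coshDist z z' ^ 3)⁻¹)
    {E : Set (ℝ × ℝ)} (hE : MeasurableSet E) (hEH : E ⊆ H2) {t : ℝ} (ht : t ∈ Icc (1 : ℝ) 2)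
    {R : ℝ} (hR : 0 ≤ R) :
    ∫⁻ z in E, ENNReal.ofReal (heatH t z (0, 1) ^ 2) ∂volG ≤
      ENNReal.ofReal K * volG (E ∩ hypBall (0, 1) R) + ENNReal.ofReal (K / cosh R) *
        ∫⁻ z in H2, ENNReal.ofReal (coshDist z (0, 1) ^ 2)⁻¹ ∂volG := by
  have hi := zero_one_mem_H2
  have hB := measurableSet_hypBall (0, 1) R
  rw [← lintegral_inter_add_sdiff _ E hB]
  gcongr ?_ + ?_
  · rw [← setLIntegral_const]
    refine setLIntegral_mono' (hE.inter hB) fun z hz => ENNReal.ofReal_le_ofReal ?_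
    refine (hbound t ht z (hEH hz.1) _ hi).trans (mul_le_of_le_one_right hK.le ?_)
    exact inv_le_one_of_one_le₀ (one_le_pow₀ (one_le_coshDist (hEH hz.1) hi))
  · rw [← lintegral_const_mul' _ _ ENNReal.ofReal_ne_top]
    refine (setLIntegral_mono' (hE.diff hB) fun z hz => ?_).trans
      (lintegral_mono_set (sdiff_subset.trans hEH))
    have hz1 : z ∈ H2 := hEH hz.1
    have hX := one_le_coshDist hz1 hi
    have hd : R ≤ hypDist z (0, 1) := by
      rw [hypDist_comm]
      by_contra! h
      exact hz.2 ⟨hz1, h⟩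
    have hXR : cosh R ≤ coshDist z (0, 1) := by
      rw [← cosh_hypDist hz1 hi, cosh_le_cosh, abs_of_nonneg hR, abs_of_nonneg (hR.trans hd)]
      exact hd
    have hcR := cosh_pos R
    rw [← ENNReal.ofReal_mul (by positivity)]
    refine ENNReal.ofReal_le_ofReal ((hbound t ht z hz1 _ hi).trans ?_)
    rw [pow_succ, mul_inv_rev, ← mul_assoc, div_eq_mul_inv]
    gcongr

theorem exists_div_cosh_le {a b : ℝ} (ha : 0 ≤ a) (hb : 0 < b) : ∃ R > 0, a / cosh R ≤ b := by
  refine ⟨a / b + 1, by positivity, ?_⟩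
  have h1 : a / b + 1 ≤ cosh (a / b + 1) :=
    (self_le_sinh_iff.2 (by positivity)).trans (sinh_lt_cosh _).le
  rw [div_le_iff₀ (cosh_pos _), ← div_le_iff₀' hb]
  linarith

/-- Kernel-level observability implies thickness: if the heat kernel at time 2 is observed
from `ω` uniformly in the base point, then `ω` is `(δ,R)`-thick for some `δ, R > 0`. -/
theorem observability_implies_thickness (ω : Set (ℝ × ℝ)) (hω : MeasurableSet ω)
    (hωH2 : ω ⊆ H2) (Cobs : ℝ) (hCobs : 0 < Cobs)
    (hobs : ∀ z₀ : ℝ × ℝ, z₀ ∈ H2 →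
      (∫⁻ z in H2, ENNReal.ofReal (heatH 2 z z₀ ^ 2) ∂volG) ≤
        ENNReal.ofReal Cobs *
          ∫⁻ s in Set.Ioc (0 : ℝ) 1,
            (∫⁻ z in ω, ENNReal.ofReal (heatH (s + 1) z z₀ ^ 2) ∂volG)) :
    ∃ R > 0, ∃ δ > 0, ∀ z₀ : ℝ × ℝ, z₀ ∈ H2 →
      ENNReal.ofReal δ ≤ volG (ω ∩ hypBall z₀ R) := by
  obtain ⟨K, hK, hbound⟩ := exists_heatH_sq_le
  have hJ := setLIntegral_inv_coshDist_sq_lt_top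
  obtain ⟨J, hJ0, hJeq⟩ : ∃ J : ℝ, 0 ≤ J ∧
      ∫⁻ z in H2, ENNReal.ofReal (coshDist z (0, 1) ^ 2)⁻¹ ∂volG = ENNReal.ofReal J :=
    ⟨_, ENNReal.toReal_nonneg, (ENNReal.ofReal_toReal hJ.ne).symm⟩
  obtain ⟨c, hc0, hc⟩ := ENNReal.lt_iff_exists_nnreal_btwn.1
    (setLIntegral_heatH_sq_pos two_pos le_rfl zero_one_mem_H2)
  have hc0 : (0 : ℝ) < c := by exact_mod_cast hc0
  obtain ⟨R, hR, hRle⟩ := exists_div_cosh_le (a := Cobs * K * J) (b := c / 2)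
    (by positivity) (by positivity)
  refine ⟨R, hR, c / 2 / (Cobs * K), by positivity, fun z₀ h₀ => ?_⟩
  have hmp := measurePreserving_similarity h₀
  have hemb := measurableEmbedding_similarity h₀
  set E := similarity z₀ ⁻¹' ω with hE
  have hEH : E ⊆ H2 := fun z hz => (similarity_mem_H2 h₀ z).1 (hωH2 hz)
  have hball : similarity z₀ ⁻¹' hypBall z₀ R = hypBall (0, 1) R := by
    ext z
    simp only [hypBall, mem_preimage, mem_sep_iff, similarity_mem_H2 h₀, hypDist_comm z₀,
      hypDist_similarity h₀, hypDist_comm (0, 1)]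
  have hvol : volG (ω ∩ hypBall z₀ R) = volG (E ∩ hypBall (0, 1) R) := by
    rw [← hball, hE, ← preimage_inter, hmp.measure_preimage_emb hemb]
  have hpull : ∀ (t : ℝ) (S : Set (ℝ × ℝ)),
      ∫⁻ z in S, ENNReal.ofReal (heatH t z z₀ ^ 2) ∂volG =
        ∫⁻ z in similarity z₀ ⁻¹' S, ENNReal.ofReal (heatH t z (0, 1) ^ 2) ∂volG := by
    intro t S
    rw [← hmp.setLIntegral_comp_preimage_emb hemb]
    simp_rw [heatH_similarity h₀]
  have hH : similarity z₀ ⁻¹' H2 = H2 := Set.ext fun z => similarity_mem_H2 h₀ z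
  have h := hobs z₀ h₀
  simp_rw [hpull, hH] at h
  rw [hvol]
  rcases eq_or_ne (volG (E ∩ hypBall (0, 1) R)) ⊤ with htop | htop
  · simp [htop]
  obtain ⟨v, hv0, hveq⟩ : ∃ v : ℝ, 0 ≤ v ∧
      volG (E ∩ hypBall (0, 1) R) = ENNReal.ofReal v :=
    ⟨_, ENNReal.toReal_nonneg, (ENNReal.ofReal_toReal htop).symm⟩
  have hcR := cosh_pos R
  have hmain : ENNReal.ofReal c ≤ ENNReal.ofReal (Cobs * (K * v + K / cosh R * J)) := by
    calc ENNReal.ofReal c = c := ENNReal.ofReal_coe_nnreal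
      _ ≤ _ := hc.le.trans h
      _ ≤ ENNReal.ofReal Cobs * ∫⁻ _ in Set.Ioc (0 : ℝ) 1,
            ENNReal.ofReal (K * v + K / cosh R * J) := by
          refine mul_le_mul_right ?_ _
          refine setLIntegral_mono' measurableSet_Ioc fun s hs => ?_
          refine (setLIntegral_heatH_sq_le hK hbound (hemb.measurable hω) hEH
            ⟨by linarith [hs.1], by linarith [hs.2]⟩ hR.le).trans_eq ?_
          rw [hveq, hJeq, ← ENNReal.ofReal_mul hK.le, ← ENNReal.ofReal_mul (by positivity),
            ← ENNReal.ofReal_add (by positivity) (by positivity)]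
      _ = _ := by
          rw [setLIntegral_const, Real.volume_Ioc, sub_zero, ENNReal.ofReal_one, mul_one,
            ENNReal.ofReal_mul hCobs.le]
  rw [ENNReal.ofReal_le_ofReal_iff (by positivity)] at hmain
  rw [hveq]
  refine ENNReal.ofReal_le_ofReal ?_
  have hJc : Cobs * (K / cosh R * J) = Cobs * K * J / cosh R := by ring
  rw [div_le_iff₀ (by positivity)]
  nlinarith
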